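/- Let 0 < m < n, let u ∈ U_{(m)} be a comb superclass representative and let λ ∈ 𝔫_{(m)}* be a comb supercharacter representative. Then χ^λ(u) ≠ 0 if and only if χ^{λ[u,k]}(u[k]) ≠ 0 for all 2 ≤ k ≤ n. -/

import Mathlib

open Matrix BigOperators
open scoped Classical

/-- `n × n` matrices over `F`. -/
abbrev Mat (n : ℕ) (F : Type*) := Matrix (Fin n) (Fin n) F

section Defs

variable {n : ℕ} {F : Type*} [Field F] [Fintype F]

/-- The pattern group `U_P` attached to a relation `P` on `{0,…,n-1}`:
unipotent upper-triangular matrices supported (off the diagonal) on positions `(i,j)` with `P i j`. -/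
def patGroup (P : Fin n → Fin n → Prop) : Set (Mat n F) :=
  {u | (∀ i, u i i = 1) ∧ ∀ i j, i ≠ j → ¬ P i j → u i j = 0}

/-- Truncation of a matrix to the positions allowed by `P` (used to identify a functional on
`𝔫_P` with the matrix of its coefficients on allowable positions). -/
noncomputable def truncP (P : Fin n → Fin n → Prop) (A : Mat n F) : Mat n F :=
  Matrix.of fun i j => if P i j then A i j else 0

/-- The left orbit `U_P λ` of the functional (identified with a matrix) `lam`:
`(aλ)(x) = λ(a⁻¹ x)`, whose coefficient matrix is the truncation of `(a⁻¹)ᵀ * λ`. -/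
noncomputable def dualLeftOrbit (P : Fin n → Fin n → Prop) (lam : Mat n F) : Set (Mat n F) :=
  {mu | ∃ a ∈ (patGroup P : Set (Mat n F)), mu = truncP P ((a⁻¹)ᵀ * lam)}

/-- The two-sided orbit `U_P λ U_P` of the functional `lam`: `(aλb)(x) = λ(a⁻¹ x b⁻¹)`,
whose coefficient matrix is the truncation of `(a⁻¹)ᵀ * λ * (b⁻¹)ᵀ`. -/
noncomputable def dualOrbit (P : Fin n → Fin n → Prop) (lam : Mat n F) : Set (Mat n F) :=
  {mu | ∃ a ∈ (patGroup P : Set (Mat n F)), ∃ b ∈ (patGroup P : Set (Mat n F)),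
    mu = truncP P ((a⁻¹)ᵀ * lam * (b⁻¹)ᵀ)}

/-- The two-sided superclass orbit `{a (v-1) b : a, b ∈ U_P}` attached to `v ∈ U_P`. -/
def classOrbit (P : Fin n → Fin n → Prop) (v : Mat n F) : Set (Mat n F) :=
  {x | ∃ a ∈ (patGroup P : Set (Mat n F)), ∃ b ∈ (patGroup P : Set (Mat n F)),
    x = a * (v - 1) * b}

/-- The pairing `λ(x) = Σ_{i,j} λ_{ij} x_{ij}` of a functional-matrix with a matrix. -/
def pairM (A B : Mat n F) : F := ∑ i, ∑ j, A i j * B i j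

/-- The supercharacter `χ^λ` of the pattern group `U_P` attached to the functional `lam`:
`χ^λ(u) = (|U_Pλ|/|U_PλU_P|) Σ_{μ ∈ U_PλU_P} θ(−μ(u−1))`. -/
noncomputable def superChar (P : Fin n → Fin n → Prop) (θ : AddChar F ℂ)
    (lam u : Mat n F) : ℂ :=
  ((dualLeftOrbit P lam).ncard : ℂ) / ((dualOrbit P lam).ncard : ℂ) *
    ∑ᶠ mu ∈ dualOrbit P lam, θ (- pairM mu (u - 1))

/-- The full order `i < j`, whose pattern group is `U_n`. -/
def Plt (n : ℕ) : Fin n → Fin n → Prop := fun i j => i < j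

/-- The poset `𝒫_(m)` (in 0-based indexing): `i < j`, except that row `0` (row `1` in 1-based
indexing) is only comparable to columns `j` with 1-based value `j+1 > m`.  Its pattern group is
the interpolating group `U_(m)`. -/
def Pm (n m : ℕ) : Fin n → Fin n → Prop := fun i j => i < j ∧ (i.val = 0 → m < j.val + 1)

/-- `𝒮_n(q)`: strictly upper-triangular matrices with at most one nonzero entry in each row
and each column. -/
def Sset (n : ℕ) (F : Type*) [Field F] : Set (Mat n F) :=
  {lam | (∀ i j : Fin n, ¬ i < j → lam i j = 0) ∧
    (∀ (i j j' : Fin n), lam i j ≠ 0 → lam i j' ≠ 0 → j = j') ∧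
    (∀ (i i' j : Fin n), lam i j ≠ 0 → lam i' j ≠ 0 → i = i')}

/-- Adjacency of two nonzero positions of `A` (they share a row or a column): the edges of
the graph `G_A`. -/
def adjRel (A : Mat n F) (p q : Fin n × Fin n) : Prop :=
  p ≠ q ∧ A p.1 p.2 ≠ 0 ∧ A q.1 q.2 ≠ 0 ∧ (p.1 = q.1 ∨ p.2 = q.2)

/-- The connected component of the position `p` in the graph `G_A`. -/
def compOf (A : Mat n F) (p : Fin n × Fin n) : Set (Fin n × Fin n) :=
  {q | Relation.ReflTransGen (adjRel A) p q}

/-- The set of connected components of the graph `G_A`. -/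
def comps (A : Mat n F) : Set (Set (Fin n × Fin n)) :=
  {S | ∃ p : Fin n × Fin n, A p.1 p.2 ≠ 0 ∧ S = compOf A p}

/-- The matrix agreeing with `A` on the positions of `S` and vanishing elsewhere. -/
noncomputable def restrictTo (S : Set (Fin n × Fin n)) (A : Mat n F) : Mat n F :=
  Matrix.of fun i j => if (i, j) ∈ S then A i j else 0

/-- At most one connected component of `G_A` has more than one vertex. -/
def AtMostOneBig (A : Mat n F) : Prop :=
  ∀ p q : Fin n × Fin n, A p.1 p.2 ≠ 0 → A q.1 q.2 ≠ 0 →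
    1 < (compOf A p).ncard → 1 < (compOf A q).ncard → compOf A p = compOf A q

end Defs

section Reps

variable {n : ℕ} {F : Type*} [Field F] [Fintype F]

/-- The vertex-set shape (in 1-based coordinates `(v.1.val + 1, v.2.val + 1)`) of the large
connected component of a comb superclass representative:
`{(1,k_1),…,(1,k_r)} ∪ {(i_1,k_1),…,(i_{r'},k_{r'})}` with
`1 ≤ i_{r'} < ⋯ < i_1 ≤ m < k_1 < ⋯ < k_r ≤ n` and `r' ∈ {r−1, r}`. -/
def CombClassComp (m : ℕ) (S : Set (Fin n × Fin n)) : Prop :=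
  ∃ r r' : ℕ, (r' = r ∨ r' + 1 = r) ∧ 1 ≤ r' ∧
    ∃ i k : ℕ → ℕ,
      (∀ d, 1 ≤ d → d < r' → i (d + 1) < i d) ∧ 1 ≤ i r' ∧ i 1 ≤ m ∧
      m < k 1 ∧ (∀ d, 1 ≤ d → d < r → k d < k (d + 1)) ∧ k r ≤ n ∧
      S = {v : Fin n × Fin n |
        (v.1.val + 1 = 1 ∧ ∃ d, 1 ≤ d ∧ d ≤ r ∧ v.2.val + 1 = k d) ∨
        (∃ d, 1 ≤ d ∧ d ≤ r' ∧ v.1.val + 1 = i d ∧ v.2.val + 1 = k d)}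

/-- `u ∈ U_(m)` is a comb superclass representative (the condition is on `A = u − 1`):
at most one connected component of `G_A` has more than one vertex, and any such component has
the comb shape. -/
def IsCombClassRep (m : ℕ) (A : Mat n F) : Prop :=
  AtMostOneBig A ∧
    ∀ p : Fin n × Fin n, A p.1 p.2 ≠ 0 → 1 < (compOf A p).ncard →
      CombClassComp m (compOf A p)

/-- The vertex-set shape of the large connected component of a path superclass representative:
`{(1,k_1)} ∪ {(i_d,k_d) : 1 ≤ d ≤ r−1} ∪ {(i_d,k_{d+1}) : 1 ≤ d ≤ r−1} ∪ E` with `E = ∅` or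
`E = {(i_r,k_r)}`, where `1 < i_{r'} < ⋯ < i_1 ≤ m < k_1 < ⋯ < k_r ≤ n`, and `r' = r` if
`E ≠ ∅`, `r' = r − 1` if `E = ∅` (`e : Bool` records whether `E ≠ ∅`). -/
def PathClassComp (m : ℕ) (S : Set (Fin n × Fin n)) : Prop :=
  ∃ (r : ℕ) (e : Bool) (i k : ℕ → ℕ),
    1 ≤ r ∧
    (∀ d, 1 ≤ d → d < (if e then r else r - 1) → i (d + 1) < i d) ∧
    1 < i (if e then r else r - 1) ∧ i 1 ≤ m ∧
    m < k 1 ∧ (∀ d, 1 ≤ d → d < r → k d < k (d + 1)) ∧ k r ≤ n ∧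
    S = {v : Fin n × Fin n |
      (v.1.val + 1 = 1 ∧ v.2.val + 1 = k 1) ∨
      (∃ d, 1 ≤ d ∧ d ≤ r - 1 ∧ v.1.val + 1 = i d ∧ v.2.val + 1 = k d) ∨
      (∃ d, 1 ≤ d ∧ d ≤ r - 1 ∧ v.1.val + 1 = i d ∧ v.2.val + 1 = k (d + 1)) ∨
      (e = true ∧ v.1.val + 1 = i r ∧ v.2.val + 1 = k r)}

/-- `u ∈ U_(m)` is a path superclass representative (the condition is on `A = u − 1`). -/
def IsPathClassRep (m : ℕ) (A : Mat n F) : Prop :=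
  AtMostOneBig A ∧
    ∀ p : Fin n × Fin n, A p.1 p.2 ≠ 0 → 1 < (compOf A p).ncard →
      PathClassComp m (compOf A p)

/-- The vertex-set shape of the large connected component of a comb supercharacter
representative: `{(1,k_1)} ∪ {(i_d,k_{d+1}) : 1 ≤ d ≤ r−1} ∪ {(i_d,k_1) : 1 ≤ d ≤ r'}` with
`n ≥ k_1 > k_2 > ⋯ > k_r > m ≥ i_{r'} > ⋯ > i_1 > 1` and `r' ∈ {r−1, r}`. -/
def CombCharComp (m : ℕ) (S : Set (Fin n × Fin n)) : Prop :=
  ∃ r r' : ℕ, (r' = r ∨ r' + 1 = r) ∧ 1 ≤ r' ∧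
    ∃ i k : ℕ → ℕ,
      (∀ d, 1 ≤ d → d < r → k (d + 1) < k d) ∧ m < k r ∧ k 1 ≤ n ∧
      (∀ d, 1 ≤ d → d < r' → i d < i (d + 1)) ∧ i r' ≤ m ∧ 1 < i 1 ∧
      S = {v : Fin n × Fin n |
        (v.1.val + 1 = 1 ∧ v.2.val + 1 = k 1) ∨
        (∃ d, 1 ≤ d ∧ d ≤ r - 1 ∧ v.1.val + 1 = i d ∧ v.2.val + 1 = k (d + 1)) ∨
        (∃ d, 1 ≤ d ∧ d ≤ r' ∧ v.1.val + 1 = i d ∧ v.2.val + 1 = k 1)}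

/-- `λ ∈ 𝔫_(m)^*` is a comb supercharacter representative. -/
def IsCombCharRep (m : ℕ) (A : Mat n F) : Prop :=
  AtMostOneBig A ∧
    ∀ p : Fin n × Fin n, A p.1 p.2 ≠ 0 → 1 < (compOf A p).ncard →
      CombCharComp m (compOf A p)

/-- The vertex-set shape of the large connected component of a path supercharacter
representative: `{(1,k_1)} ∪ {(i_d,k_d) : 1 ≤ d ≤ r−1} ∪ {(i_d,k_{d+1}) : 1 ≤ d ≤ r−1} ∪ E`
with `E = ∅` or `E = {(i_r,k_r)}`, where `n ≥ k_1 > ⋯ > k_r > m ≥ i_{r'} > ⋯ > i_1 > 1`, and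
`r' = r` if `E ≠ ∅`, `r' = r − 1` if `E = ∅`. -/
def PathCharComp (m : ℕ) (S : Set (Fin n × Fin n)) : Prop :=
  ∃ (r : ℕ) (e : Bool) (i k : ℕ → ℕ),
    1 ≤ r ∧
    (∀ d, 1 ≤ d → d < r → k (d + 1) < k d) ∧ m < k r ∧ k 1 ≤ n ∧
    (∀ d, 1 ≤ d → d < (if e then r else r - 1) → i d < i (d + 1)) ∧
    i (if e then r else r - 1) ≤ m ∧ 1 < i 1 ∧
    S = {v : Fin n × Fin n |
      (v.1.val + 1 = 1 ∧ v.2.val + 1 = k 1) ∨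
      (∃ d, 1 ≤ d ∧ d ≤ r - 1 ∧ v.1.val + 1 = i d ∧ v.2.val + 1 = k d) ∨
      (∃ d, 1 ≤ d ∧ d ≤ r - 1 ∧ v.1.val + 1 = i d ∧ v.2.val + 1 = k (d + 1)) ∨
      (e = true ∧ v.1.val + 1 = i r ∧ v.2.val + 1 = k r)}

/-- `λ ∈ 𝔫_(m)^*` is a path supercharacter representative. -/
def IsPathCharRep (m : ℕ) (A : Mat n F) : Prop :=
  AtMostOneBig A ∧
    ∀ p : Fin n × Fin n, A p.1 p.2 ≠ 0 → 1 < (compOf A p).ncard →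
      PathCharComp m (compOf A p)

end Reps

section ColumnDefs

variable {n : ℕ} {F : Type*} [Field F] [Fintype F]

/-- `u[k]`: the unipotent matrix agreeing with `u` in column `k` (off the diagonal) and equal
to the identity elsewhere. -/
noncomputable def uCol (u : Mat n F) (k : Fin n) : Mat n F :=
  1 + Matrix.of fun i j => if j = k then (u - 1) i j else 0

/-- `λ[u,k]`: the functional agreeing with `λ` at positions `(i,l)` with `l ≥ k` such that
`u_{jk} ≠ 0` for some `i ≤ j < k`, and vanishing elsewhere. -/
noncomputable def lamUK (lam u : Mat n F) (k : Fin n) : Mat n F :=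
  Matrix.of fun i l =>
    if k ≤ l ∧ ∃ j : Fin n, i ≤ j ∧ j < k ∧ u j k ≠ 0 then lam i l else 0

end ColumnDefs

section PatternGroup

variable {n : ℕ} {F : Type*} [Field F] [Fintype F] {P : Fin n → Fin n → Prop}

/-- The pattern group `U_P` over `F`, as a type. -/
abbrev PatternGroup (F : Type*) [Field F] (P : Fin n → Fin n → Prop) : Type _ :=
  ↥(patGroup P : Set (Mat n F))

/-- The matrices supported on the positions allowed by `P`. -/
def patAlgebra (F : Type*) [Field F] (P : Fin n → Fin n → Prop) : Submodule F (Mat n F) where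
  carrier := {y | ∀ i j, ¬ P i j → y i j = 0}
  add_mem' := by
    intro a b ha hb i j h
    simp [ha i j h, hb i j h]
  zero_mem' := by
    intro i j _
    rfl
  smul_mem' := by
    intro c a ha i j h
    simp [ha i j h]

omit [Fintype F] in
lemma mem_patAlgebra {y : Mat n F} : y ∈ patAlgebra F P ↔ ∀ i j, ¬ P i j → y i j = 0 := Iff.rfl

omit [Fintype F] in
lemma single_mem_patAlgebra {i j : Fin n} (h : P i j) :
    Matrix.single i j (1 : F) ∈ patAlgebra F P := by
  intro a b hab
  rw [Matrix.single_apply, if_neg]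
  rintro ⟨rfl, rfl⟩
  exact hab h

omit [Fintype F] in
lemma one_add_mem_patGroup (hlt : ∀ i j, P i j → i < j) {y : Mat n F}
    (hy : y ∈ patAlgebra F P) : 1 + y ∈ patGroup P := by
  refine ⟨fun i => ?_, fun i j hij h => ?_⟩
  · simp [hy i i fun h => lt_irrefl _ (hlt _ _ h)]
  · simp [hy i j h, hij]

omit [Fintype F] in
lemma sub_one_mem_patAlgebra {u : Mat n F} (hu : u ∈ patGroup P) : u - 1 ∈ patAlgebra F P := by
  intro i j h
  by_cases hij : i = j
  · subst hij
    simp [hu.1 i]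
  · simp [hu.2 i j hij h, hij]

omit [Fintype F] in
lemma one_mem_patGroup : (1 : Mat n F) ∈ patGroup P :=
  ⟨fun i => by simp, fun i j hij _ => by simp [hij]⟩

omit [Fintype F] in
lemma eq_or_of_patGroup_ne_zero {a : Mat n F} (ha : a ∈ patGroup P) {i j : Fin n}
    (h : a i j ≠ 0) : i = j ∨ P i j := by
  by_contra! hc
  exact h (ha.2 i j hc.1 hc.2)

omit [Fintype F] in
lemma mul_mem_patGroup (hlt : ∀ i j, P i j → i < j) (htr : ∀ i j k, P i j → P j k → P i k)
    {a b : Mat n F} (ha : a ∈ patGroup P) (hb : b ∈ patGroup P) : a * b ∈ patGroup P := by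
  refine ⟨fun i => ?_, fun i j hij h => ?_⟩
  · rw [Matrix.mul_apply, Finset.sum_eq_single i]
    · simp [ha.1, hb.1]
    · intro t _ hti
      by_contra hne
      rcases eq_or_of_patGroup_ne_zero ha (left_ne_zero_of_mul hne) with h1 | h1
      · exact hti h1.symm
      rcases eq_or_of_patGroup_ne_zero hb (right_ne_zero_of_mul hne) with h2 | h2
      · exact hti h2
      exact lt_asymm (hlt _ _ h1) (hlt _ _ h2)
    · simp
  · rw [Matrix.mul_apply]
    refine Finset.sum_eq_zero fun t _ => ?_
    by_contra hne
    rcases eq_or_of_patGroup_ne_zero ha (left_ne_zero_of_mul hne) with rfl | h1 <;>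
      rcases eq_or_of_patGroup_ne_zero hb (right_ne_zero_of_mul hne) with rfl | h2
    · exact hij rfl
    · exact h h2
    · exact h h1
    · exact h (htr _ _ _ h1 h2)

omit [Fintype F] in
lemma isUnit_det_of_mem_patGroup (hlt : ∀ i j, P i j → i < j) {a : Mat n F}
    (ha : a ∈ patGroup P) : IsUnit a.det := by
  have hup : a.BlockTriangular id := by
    intro i j hij
    exact ha.2 i j (ne_of_gt hij) fun h => lt_asymm (hlt _ _ h) hij
  rw [Matrix.det_of_isUpperTriangular hup]
  simp [ha.1]

lemma inv_mem_patGroup (hlt : ∀ i j, P i j → i < j) (htr : ∀ i j k, P i j → P j k → P i k)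
    {a : Mat n F} (ha : a ∈ patGroup P) : a⁻¹ ∈ patGroup P := by
  have hdet := isUnit_det_of_mem_patGroup hlt ha
  let f : PatternGroup F P → PatternGroup F P :=
    fun b => ⟨a * b, mul_mem_patGroup hlt htr ha b.2⟩
  have hf : Function.Injective f := by
    intro b c hbc
    have h : a * (b : Mat n F) = a * c := congrArg Subtype.val hbc
    have h' := congrArg (a⁻¹ * ·) h
    simp only [Matrix.nonsing_inv_mul_cancel_left _ _ hdet] at h'
    exact Subtype.ext h'
  obtain ⟨b, hb⟩ := (Finite.injective_iff_surjective.1 hf) ⟨1, one_mem_patGroup⟩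
  rw [Matrix.inv_eq_right_inv (congrArg Subtype.val hb)]
  exact b.2

omit [Fintype F] in
/-- The coefficients of `cᵀ * A * dᵀ` on allowed positions only involve those of `A`. -/
lemma truncP_mul_truncP_mul (htr : ∀ i j k, P i j → P j k → P i k) {c d : Mat n F}
    (hc : c ∈ patGroup P) (hd : d ∈ patGroup P) (A : Mat n F) :
    truncP P (cᵀ * truncP P A * dᵀ) = truncP P (cᵀ * A * dᵀ) := by
  ext i j
  by_cases hij : P i j
  · simp only [truncP, Matrix.of_apply, if_pos hij, Matrix.mul_apply, Matrix.transpose_apply]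
    refine Finset.sum_congr rfl fun s _ => ?_
    by_cases hs : d j s = 0
    · simp [hs]
    congr 1
    refine Finset.sum_congr rfl fun t _ => ?_
    by_cases ht : c t i = 0
    · simp [ht]
    rw [if_pos]
    rcases eq_or_of_patGroup_ne_zero hc ht with rfl | h1 <;>
      rcases eq_or_of_patGroup_ne_zero hd hs with rfl | h2
    · exact hij
    · exact htr _ _ _ hij h2
    · exact htr _ _ _ h1 hij
    · exact htr _ _ _ h1 (htr _ _ _ hij h2)
  · simp [truncP, hij]

omit [Fintype F] in
lemma pairM_truncP {X : Mat n F} (hX : X ∈ patAlgebra F P) (A : Mat n F) :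
    pairM (truncP P A) X = pairM A X := by
  unfold pairM
  refine Finset.sum_congr rfl fun i _ => Finset.sum_congr rfl fun j _ => ?_
  by_cases hij : P i j
  · simp [truncP, hij]
  · simp [hX i j hij]

/-- The fibres of the parametrisation `(a, b) ↦ aᵀ λ bᵀ` of a two-sided orbit have the same
cardinality. -/
lemma card_fiber_dualOrbit (hlt : ∀ i j, P i j → i < j)
    (htr : ∀ i j k, P i j → P j k → P i k) (lam : Mat n F) {a b : Mat n F}
    (ha : a ∈ patGroup P) (hb : b ∈ patGroup P) :
    Nat.card {p : PatternGroup F P × PatternGroup F P //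
        truncP P ((p.1 : Mat n F)ᵀ * lam * (p.2 : Mat n F)ᵀ) = truncP P (aᵀ * lam * bᵀ)} =
      Nat.card {p : PatternGroup F P × PatternGroup F P //
        truncP P ((p.1 : Mat n F)ᵀ * lam * (p.2 : Mat n F)ᵀ) = truncP P lam} := by
  have hda := isUnit_det_of_mem_patGroup hlt ha
  have hdb := isUnit_det_of_mem_patGroup hlt hb
  have hai := inv_mem_patGroup hlt htr ha
  have hbi := inv_mem_patGroup hlt htr hb
  have key : ∀ {c d : Mat n F}, c ∈ patGroup P → d ∈ patGroup P → ∀ {A B : Mat n F},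
      truncP P A = truncP P B → truncP P (cᵀ * A * dᵀ) = truncP P (cᵀ * B * dᵀ) := by
    intro c d hc hd A B h
    rw [← truncP_mul_truncP_mul htr hc hd A, h, truncP_mul_truncP_mul htr hc hd B]
  refine Nat.card_congr
    { toFun := fun p => ⟨(⟨p.1.1 * a⁻¹, mul_mem_patGroup hlt htr p.1.1.2 hai⟩,
        ⟨b⁻¹ * p.1.2, mul_mem_patGroup hlt htr hbi p.1.2.2⟩), ?_⟩
      invFun := fun p => ⟨(⟨p.1.1 * a, mul_mem_patGroup hlt htr p.1.1.2 ha⟩,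
        ⟨b * p.1.2, mul_mem_patGroup hlt htr hb p.1.2.2⟩), ?_⟩
      left_inv := ?_
      right_inv := ?_ }
  · have h := key hai hbi p.2
    have h1 : (a⁻¹)ᵀ * (aᵀ * lam * bᵀ) * (b⁻¹)ᵀ = lam := by
      have e1 : (a⁻¹)ᵀ * aᵀ = 1 := by
        rw [← Matrix.transpose_mul, Matrix.mul_nonsing_inv _ hda, Matrix.transpose_one]
      have e2 : bᵀ * (b⁻¹)ᵀ = 1 := by
        rw [← Matrix.transpose_mul, Matrix.nonsing_inv_mul _ hdb, Matrix.transpose_one]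
      calc (a⁻¹)ᵀ * (aᵀ * lam * bᵀ) * (b⁻¹)ᵀ = ((a⁻¹)ᵀ * aᵀ) * lam * (bᵀ * (b⁻¹)ᵀ) := by
            simp only [Matrix.mul_assoc]
        _ = lam := by rw [e1, e2, Matrix.one_mul, Matrix.mul_one]
    rw [h1] at h
    rw [← h]
    simp only [Matrix.transpose_mul, Matrix.mul_assoc]
  · have h := key ha hb p.2
    rw [← h]
    simp only [Matrix.transpose_mul, Matrix.mul_assoc]
  · rintro ⟨⟨p, q⟩, h⟩
    simp [Matrix.nonsing_inv_mul_cancel_right _ _ hda, Matrix.mul_nonsing_inv_cancel_left _ _ hdb]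
  · rintro ⟨⟨p, q⟩, h⟩
    simp [Matrix.mul_nonsing_inv_cancel_right _ _ hda, Matrix.nonsing_inv_mul_cancel_left _ _ hdb]

/-- The sum over a two-sided orbit is, up to a positive factor, a sum over the group. -/
lemma exists_sum_patGroup_eq (hlt : ∀ i j, P i j → i < j)
    (htr : ∀ i j k, P i j → P j k → P i k) (lam : Mat n F) (f : Mat n F → ℂ) :
    ∃ c : ℕ, c ≠ 0 ∧
      ∑ p : PatternGroup F P × PatternGroup F P,
        f (truncP P ((p.1 : Mat n F)ᵀ * lam * (p.2 : Mat n F)ᵀ)) =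
      c * ∑ᶠ mu ∈ dualOrbit P lam, f mu := by
  let φ : PatternGroup F P × PatternGroup F P → Mat n F := fun p => truncP P ((p.1 : Mat n F)ᵀ * lam * (p.2 : Mat n F)ᵀ)
  refine ⟨Nat.card {p : PatternGroup F P × PatternGroup F P // φ p = truncP P lam}, ?_, ?_⟩
  · have : Nonempty {p : PatternGroup F P × PatternGroup F P // φ p = truncP P lam} :=
      ⟨⟨(⟨1, one_mem_patGroup⟩, ⟨1, one_mem_patGroup⟩), by simp [φ]⟩⟩
    exact Nat.card_pos.ne'
  · have hO : dualOrbit P lam = ((Finset.univ.image φ : Finset (Mat n F)) : Set (Mat n F)) := by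
      ext mu
      simp only [dualOrbit, Set.mem_ofPred_eq, Finset.coe_image, Finset.coe_univ, Set.image_univ,
        Set.mem_range]
      constructor
      · rintro ⟨a, ha, b, hb, rfl⟩
        exact ⟨(⟨a⁻¹, inv_mem_patGroup hlt htr ha⟩, ⟨b⁻¹, inv_mem_patGroup hlt htr hb⟩), rfl⟩
      · rintro ⟨⟨⟨a, ha⟩, ⟨b, hb⟩⟩, rfl⟩
        refine ⟨a⁻¹, inv_mem_patGroup hlt htr ha, b⁻¹, inv_mem_patGroup hlt htr hb, ?_⟩
        rw [Matrix.nonsing_inv_nonsing_inv _ (isUnit_det_of_mem_patGroup hlt ha),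
          Matrix.nonsing_inv_nonsing_inv _ (isUnit_det_of_mem_patGroup hlt hb)]
    rw [hO, finsum_mem_coe_finset, Finset.mul_sum]
    change ∑ p, f (φ p) = _
    rw [Finset.sum_comp]
    refine Finset.sum_congr rfl fun mu hmu => ?_
    obtain ⟨⟨⟨a, ha⟩, ⟨b, hb⟩⟩, -, rfl⟩ := Finset.mem_image.1 hmu
    rw [nsmul_eq_mul, ← card_fiber_dualOrbit hlt htr lam ha hb, Nat.card_eq_fintype_card,
      Fintype.card_subtype]

lemma superChar_ne_zero_iff_finsum (hlt : ∀ i j, P i j → i < j)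
    (htr : ∀ i j k, P i j → P j k → P i k) (θ : AddChar F ℂ) (lam : Mat n F) (u : Mat n F)
    (hu : u - 1 ∈ patAlgebra F P) :
    superChar P θ lam u ≠ 0 ↔
      ∑ y : patAlgebra F P, ∑ z : patAlgebra F P,
        θ (- pairM ((1 + (y : Mat n F))ᵀ * lam * (1 + (z : Mat n F))ᵀ) (u - 1)) ≠ 0 := by
  have h1 : ((dualLeftOrbit P lam).ncard : ℂ) ≠ 0 := by
    rw [Nat.cast_ne_zero]
    exact Set.ncard_ne_zero_of_mem ⟨1, one_mem_patGroup, rfl⟩ (Set.toFinite _)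
  have h2 : ((dualOrbit P lam).ncard : ℂ) ≠ 0 := by
    rw [Nat.cast_ne_zero]
    exact Set.ncard_ne_zero_of_mem ⟨1, one_mem_patGroup, 1, one_mem_patGroup, rfl⟩
      (Set.toFinite _)
  obtain ⟨c, hc, hsum⟩ := exists_sum_patGroup_eq hlt htr lam fun mu => θ (- pairM mu (u - 1))
  let e : patAlgebra F P ≃ PatternGroup F P :=
    { toFun := fun y => ⟨1 + y, one_add_mem_patGroup hlt y.2⟩
      invFun := fun a => ⟨a - 1, sub_one_mem_patAlgebra a.2⟩
      left_inv := fun y => by simp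
      right_inv := fun a => by simp }
  have h3 : ∑ y : patAlgebra F P, ∑ z : patAlgebra F P,
        θ (- pairM ((1 + (y : Mat n F))ᵀ * lam * (1 + (z : Mat n F))ᵀ) (u - 1)) =
      c * ∑ᶠ mu ∈ dualOrbit P lam, θ (- pairM mu (u - 1)) := by
    rw [← hsum, ← Fintype.sum_prod_type', ← Equiv.sum_comp (e.prodCongr e)]
    refine Finset.sum_congr rfl fun p _ => ?_
    rw [pairM_truncP hu]
    rfl
  rw [h3, superChar, mul_ne_zero_iff, mul_ne_zero_iff]
  exact ⟨fun h => ⟨Nat.cast_ne_zero.2 hc, h.2⟩, fun h => ⟨div_ne_zero h1 h2, h.2⟩⟩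

end PatternGroup

section CharacterSums

variable {F V : Type*} [Field F] [AddCommGroup V] [Module F V] [Fintype V]

lemma sum_addChar_linearMap_eq_zero {θ : AddChar F ℂ} (hθ : ∃ x, θ x ≠ 1) {f : V →ₗ[F] F}
    (hf : ∃ v, f v ≠ 0) : ∑ v, θ (f v) = 0 := by
  have h : θ.compAddMonoidHom f.toAddMonoidHom ≠ 0 := by
    obtain ⟨x, hx⟩ := hθ
    obtain ⟨v, hv⟩ := hf
    intro h
    have := DFunLike.congr_fun h ((x / f v) • v)
    simp [hv] at this
    exact hx this
  simpa using AddChar.sum_eq_zero_iff_ne_zero.2 h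

lemma sum_addChar_linearMap_of_eq_zero {θ : AddChar F ℂ} {f : V →ₗ[F] F} (hf : ∀ v, f v = 0) :
    ∑ v, θ (f v) = Fintype.card V := by
  simp [hf]

/-- A complete character sum of an affine-bilinear phase is nonzero exactly when the phase has
a critical point in each variable. -/
lemma sum_sum_addChar_ne_zero_iff {θ : AddChar F ℂ} (hθ : ∃ x, θ x ≠ 1) (c : F)
    (f g : V →ₗ[F] F) (B : V →ₗ[F] V →ₗ[F] F) :
    ∑ y, ∑ z, θ (c + f z + g y + B y z) ≠ 0 ↔
      (∃ y, ∀ z, f z + B y z = 0) ∧ (∃ z, ∀ y, g y + B y z = 0) := by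
  constructor
  · intro h
    constructor
    · by_contra! hc
      refine h (Finset.sum_eq_zero fun y _ => ?_)
      have h0 := sum_addChar_linearMap_eq_zero hθ (f := f + B y) (hc y)
      calc ∑ z, θ (c + f z + g y + B y z) = ∑ z, θ (c + g y) * θ ((f + B y) z) := by
            refine Finset.sum_congr rfl fun z _ => ?_
            rw [← AddChar.map_add_eq_mul, LinearMap.add_apply]
            congr 1
            ring
        _ = 0 := by rw [← Finset.mul_sum, h0, mul_zero]
    · by_contra! hc
      rw [Finset.sum_comm] at h
      refine h (Finset.sum_eq_zero fun z _ => ?_)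
      have h0 := sum_addChar_linearMap_eq_zero hθ (f := g + B.flip z) (hc z)
      calc ∑ y, θ (c + f z + g y + B y z) = ∑ y, θ (c + f z) * θ ((g + B.flip z) y) := by
            refine Finset.sum_congr rfl fun y _ => ?_
            rw [← AddChar.map_add_eq_mul, LinearMap.add_apply, LinearMap.flip_apply]
            congr 1
            ring
        _ = 0 := by rw [← Finset.mul_sum, h0, mul_zero]
  · rintro ⟨⟨y₀, hy₀⟩, ⟨z₀, hz₀⟩⟩
    have hshift : ∑ y, ∑ z, θ (c + f z + g y + B y z) =
        θ (c + f z₀) * ∑ y, ∑ z, θ (B y z) := by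
      rw [← Equiv.sum_comp (Equiv.addLeft y₀), Finset.mul_sum]
      refine Finset.sum_congr rfl fun y _ => ?_
      rw [← Equiv.sum_comp (Equiv.addLeft z₀), Finset.mul_sum]
      refine Finset.sum_congr rfl fun z _ => ?_
      rw [← AddChar.map_add_eq_mul]
      congr 1
      simp only [Equiv.coe_addLeft, map_add, LinearMap.add_apply]
      linear_combination hy₀ z + hz₀ y + hz₀ y₀
    have hsum : ∑ y, ∑ z, θ (B y z) =
        ((Finset.univ.filter fun y => ∀ z, B y z = 0).card * Fintype.card V : ℕ) := by
      rw [← Finset.sum_filter_add_sum_filter_not _ fun y => ∀ z, B y z = 0]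
      rw [Finset.sum_congr rfl fun y hy =>
        sum_addChar_linearMap_of_eq_zero (θ := θ) (Finset.mem_filter.1 hy).2]
      rw [Finset.sum_eq_zero (s := Finset.univ.filter fun y => ¬ ∀ z, B y z = 0) fun y hy =>
        sum_addChar_linearMap_eq_zero hθ (not_forall.1 (Finset.mem_filter.1 hy).2)]
      simp
    rw [hshift, hsum]
    refine mul_ne_zero (θ.val_isUnit _).ne_zero (Nat.cast_ne_zero.2 (mul_ne_zero ?_ ?_))
    · exact Finset.card_ne_zero_of_mem (Finset.mem_filter.2 ⟨Finset.mem_univ 0, by simp⟩)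
    · exact Fintype.card_ne_zero

end CharacterSums

section Criterion

variable {n : ℕ} {F : Type*} [Field F] {P : Fin n → Fin n → Prop}

/-- The pairing `λ ↦ λ(X)` as a linear map. -/
def pairLin (X : Mat n F) : Mat n F →ₗ[F] F where
  toFun A := pairM A X
  map_add' A B := by simp [pairM, add_mul, Finset.sum_add_distrib]
  map_smul' c A := by simp [pairM, Finset.mul_sum, mul_assoc]

lemma pairM_eq_trace (A X : Mat n F) : pairM A X = (Xᵀ * A).trace := by
  simp only [pairM, Matrix.trace, Matrix.diag, Matrix.mul_apply, Matrix.transpose_apply]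
  rw [Finset.sum_comm]
  simp only [mul_comm]

lemma pairM_mul_transpose (A z X : Mat n F) : pairM (A * zᵀ) X = pairM z (Xᵀ * A) := by
  rw [pairM_eq_trace, pairM_eq_trace, ← Matrix.mul_assoc, Matrix.trace_mul_comm,
    ← Matrix.trace_transpose]
  simp

lemma pairM_transpose_mul (A y X : Mat n F) : pairM (yᵀ * A) X = pairM y (A * Xᵀ) := by
  rw [pairM_eq_trace, pairM_eq_trace, ← Matrix.trace_transpose]
  simp only [Matrix.transpose_mul, Matrix.transpose_transpose]
  rw [Matrix.mul_assoc, Matrix.trace_mul_comm, Matrix.mul_assoc, Matrix.trace_mul_comm]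

lemma forall_pairM_eq_zero_iff (M : Mat n F) :
    (∀ z ∈ patAlgebra F P, pairM z M = 0) ↔ ∀ i j, P i j → M i j = 0 := by
  constructor
  · intro h i j hij
    simpa [pairM, Matrix.single_apply, ite_and] using h _ (single_mem_patAlgebra hij)
  · intro h z hz
    refine Finset.sum_eq_zero fun i _ => Finset.sum_eq_zero fun j _ => ?_
    by_cases hij : P i j
    · simp [h i j hij]
    · simp [hz i j hij]

/-- Some left translate of `λ` annihilates the space `X 𝔫_P`. -/
def LeftSolvable (P : Fin n → Fin n → Prop) (lam X : Mat n F) : Prop :=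
  ∃ y ∈ patAlgebra F P, ∀ l j, P l j → (Xᵀ * ((1 + y)ᵀ * lam) : Mat n F) l j = 0

/-- Some right translate of `λ` annihilates the space `𝔫_P X`. -/
def RightSolvable (P : Fin n → Fin n → Prop) (lam X : Mat n F) : Prop :=
  ∃ z ∈ patAlgebra F P, ∀ i j, P i j → (lam * (1 + z)ᵀ * Xᵀ : Mat n F) i j = 0

/-- Nonvanishing of a supercharacter value of a pattern group, as a pair of solvability
conditions. -/
lemma superChar_ne_zero_iff [Fintype F] (hlt : ∀ i j, P i j → i < j)
    (htr : ∀ i j k, P i j → P j k → P i k) {θ : AddChar F ℂ} (hθ : ∃ x, θ x ≠ 1)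
    (lam u : Mat n F) (hu : u - 1 ∈ patAlgebra F P) :
    superChar P θ lam u ≠ 0 ↔
      LeftSolvable P lam (u - 1) ∧ RightSolvable P lam (u - 1) := by
  set X := u - 1
  let L := pairLin X
  let f : patAlgebra F P →ₗ[F] F :=
    { toFun := fun z => - L (lam * (z : Mat n F)ᵀ)
      map_add' := fun a b => by simp [Matrix.mul_add, add_comm]
      map_smul' := fun c a => by simp }
  let g : patAlgebra F P →ₗ[F] F :=
    { toFun := fun y => - L ((y : Mat n F)ᵀ * lam)
      map_add' := fun a b => by simp [Matrix.add_mul, add_comm]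
      map_smul' := fun c a => by simp }
  let B : patAlgebra F P →ₗ[F] patAlgebra F P →ₗ[F] F :=
    LinearMap.mk₂ F (fun y z => - L ((y : Mat n F)ᵀ * lam * (z : Mat n F)ᵀ))
      (fun a b z => by simp [Matrix.add_mul, add_comm])
      (fun c a z => by simp)
      (fun a b z => by simp [Matrix.mul_add, add_comm])
      (fun c a z => by simp)
  rw [superChar_ne_zero_iff_finsum hlt htr θ lam u hu]
  have hexp : ∀ y z : patAlgebra F P,
      θ (- pairM ((1 + (y : Mat n F))ᵀ * lam * (1 + (z : Mat n F))ᵀ) (u - 1)) =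
        θ (- L lam + f z + g y + B y z) := by
    intro y z
    change θ (- L _) = θ (- L lam + - L _ + - L _ + - L _)
    rw [← neg_add, ← neg_add, ← neg_add, ← map_add, ← map_add, ← map_add]
    congr 3
    simp only [Matrix.transpose_add, Matrix.transpose_one]
    noncomm_ring
  simp only [hexp]
  rw [sum_sum_addChar_ne_zero_iff hθ]
  refine and_congr ?_ ?_
  · have key : ∀ y z : patAlgebra F P,
        f z + B y z = - pairM (z : Mat n F) (Xᵀ * ((1 + (y : Mat n F))ᵀ * lam)) := by
      intro y z
      rw [← pairM_mul_transpose]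
      change - L _ + - L _ = - L _
      rw [← neg_add, ← map_add]
      congr 2
      simp only [Matrix.transpose_add, Matrix.transpose_one]
      noncomm_ring
    simp only [key, neg_eq_zero]
    simp only [Subtype.forall, Subtype.exists, forall_pairM_eq_zero_iff, LeftSolvable,
      exists_prop]
  · have key : ∀ z y : patAlgebra F P,
        g y + B y z = - pairM (y : Mat n F) (lam * (1 + (z : Mat n F))ᵀ * Xᵀ) := by
      intro z y
      rw [← pairM_transpose_mul]
      change - L _ + - L _ = - L _
      rw [← neg_add, ← map_add]
      congr 2
      simp only [Matrix.transpose_add, Matrix.transpose_one]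
      noncomm_ring
    simp only [key, neg_eq_zero]
    simp only [Subtype.forall, Subtype.exists, forall_pairM_eq_zero_iff, RightSolvable,
      exists_prop]

end Criterion

section Columns

variable {n m : ℕ} {F : Type*} [Field F]

lemma Pm_lt (i j : Fin n) (h : Pm n m i j) : i < j := h.1

lemma Pm_trans (i j k : Fin n) (h₁ : Pm n m i j) (h₂ : Pm n m j k) : Pm n m i k :=
  ⟨h₁.1.trans h₂.1, fun h => (h₁.2 h).trans_le (Nat.succ_le_succ h₂.1.le)⟩

lemma lt_of_patAlgebra_ne_zero {y : Mat n F} (hy : y ∈ patAlgebra F (Pm n m)) {i j : Fin n}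
    (h : y i j ≠ 0) : i < j := by
  by_contra hc
  exact h (hy i j fun hP => hc hP.1)

lemma uCol_sub_one_apply [Fintype F] (u : Mat n F) (k i j : Fin n) :
    (uCol u k - 1) i j = if j = k then (u - 1) i j else 0 := by
  simp [uCol]

lemma uCol_sub_one_mem [Fintype F] {u : Mat n F} (hu : u - 1 ∈ patAlgebra F (Pm n m))
    (k : Fin n) : uCol u k - 1 ∈ patAlgebra F (Pm n m) := by
  intro i j h
  rw [uCol_sub_one_apply, hu i j h, ite_self]

lemma lamUK_apply_of_ne_zero [Fintype F] {u : Mat n F} (hu : u - 1 ∈ patAlgebra F (Pm n m))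
    (lam : Mat n F) {i j k l : Fin n} (hj : (u - 1) j k ≠ 0) (hij : i ≤ j) (hkl : k ≤ l) :
    lamUK lam u k i l = lam i l := by
  have hjk := lt_of_patAlgebra_ne_zero hu hj
  have huj : u j k ≠ 0 := by simpa [Matrix.sub_apply, hjk.ne] using hj
  simp only [lamUK, Matrix.of_apply]
  rw [if_pos ⟨hkl, j, hij, hjk, huj⟩]

lemma one_add_apply_eq_zero {y : Mat n F} (hy : y ∈ patAlgebra F (Pm n m)) {i j : Fin n}
    (h : j < i) : (1 + y) i j = 0 := by
  simp [hy i j fun hP => lt_asymm h hP.1, h.ne']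

lemma left_column_eq [Fintype F] {u : Mat n F} (hu : u - 1 ∈ patAlgebra F (Pm n m))
    (lam : Mat n F) {y : Mat n F} (hy : y ∈ patAlgebra F (Pm n m)) {k j : Fin n} (hkj : k < j) :
    ((uCol u k - 1)ᵀ * ((1 + y)ᵀ * lamUK lam u k) : Mat n F) k j =
      ((u - 1)ᵀ * ((1 + y)ᵀ * lam) : Mat n F) k j := by
  simp only [Matrix.mul_apply, Matrix.transpose_apply, uCol_sub_one_apply, if_true]
  refine Finset.sum_congr rfl fun i _ => ?_
  by_cases hi : (u - 1) i k = 0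
  · rw [hi, zero_mul, zero_mul]
  congr 1
  refine Finset.sum_congr rfl fun t _ => ?_
  rcases lt_or_ge i t with h | h
  · rw [one_add_apply_eq_zero hy h, zero_mul, zero_mul]
  · rw [lamUK_apply_of_ne_zero hu lam hi h hkj.le]

lemma right_row_eq [Fintype F] {u : Mat n F} (hu : u - 1 ∈ patAlgebra F (Pm n m))
    (lam : Mat n F) {z : Mat n F} (hz : z ∈ patAlgebra F (Pm n m)) {i j k : Fin n} (hij : i < j) :
    (lamUK lam u k * (1 + z)ᵀ * (uCol u k - 1)ᵀ : Mat n F) i j =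
      (lam * (1 + z)ᵀ : Mat n F) i k * (u - 1) j k := by
  rw [Matrix.mul_apply, Finset.sum_eq_single k]
  · rw [Matrix.transpose_apply, uCol_sub_one_apply, if_pos rfl]
    by_cases hj : (u - 1) j k = 0
    · rw [hj, mul_zero, mul_zero]
    congr 1
    simp only [Matrix.mul_apply, Matrix.transpose_apply]
    refine Finset.sum_congr rfl fun s _ => ?_
    rcases lt_or_ge s k with h | h
    · rw [one_add_apply_eq_zero hz h, mul_zero, mul_zero]
    · rw [lamUK_apply_of_ne_zero hu lam hj hij.le h]
  · intro l _ hl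
    rw [Matrix.transpose_apply, uCol_sub_one_apply, if_neg hl, mul_zero]
  · simp

variable [Fintype F] {u : Mat n F}

lemma leftSolvable_iff_columns (hu : u - 1 ∈ patAlgebra F (Pm n m))
    (hrow : ∀ i j j' : Fin n, i.val ≠ 0 → (u - 1) i j ≠ 0 → (u - 1) i j' ≠ 0 → j = j')
    (lam : Mat n F) :
    LeftSolvable (Pm n m) lam (u - 1) ↔
      ∀ k : Fin n, 1 ≤ k.val → LeftSolvable (Pm n m) (lamUK lam u k) (uCol u k - 1) := by
  constructor
  · rintro ⟨y, hy, h⟩ k -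
    refine ⟨y, hy, fun l j hlj => ?_⟩
    by_cases hl : l = k
    · subst hl
      rw [left_column_eq hu lam hy hlj.1, h l j hlj]
    · rw [Matrix.mul_apply]
      refine Finset.sum_eq_zero fun i _ => ?_
      rw [Matrix.transpose_apply, uCol_sub_one_apply, if_neg hl, zero_mul]
  · intro h
    choose Y hY hYz using h
    let y : Mat n F := Matrix.of fun t i =>
      if hi : ∃ k : Fin n, 1 ≤ k.val ∧ (u - 1) i k ≠ 0
        then Y hi.choose hi.choose_spec.1 t i else 0
    have hy : y ∈ patAlgebra F (Pm n m) := by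
      intro t i hti
      simp only [y, Matrix.of_apply]
      split_ifs with hi
      · exact hY _ _ t i hti
      · rfl
    refine ⟨y, hy, fun l j hlj => ?_⟩
    by_cases hl : 1 ≤ l.val
    · rw [← hYz l hl l j hlj, left_column_eq hu lam (hY l hl) hlj.1, Matrix.mul_apply,
        Matrix.mul_apply]
      refine Finset.sum_congr rfl fun i _ => ?_
      by_cases hi : (u - 1) i l = 0
      · rw [Matrix.transpose_apply, hi, zero_mul, zero_mul]
      congr 1
      rw [Matrix.mul_apply, Matrix.mul_apply]
      refine Finset.sum_congr rfl fun t _ => ?_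
      congr 1
      rw [Matrix.transpose_apply, Matrix.transpose_apply, Matrix.add_apply, Matrix.add_apply]
      congr 1
      by_cases hi0 : i.val = 0
      · have hti : ¬ Pm n m t i := fun hP => by
          have := Fin.lt_def.1 hP.1
          omega
        rw [hy t i hti, hY l hl t i hti]
      · have hex : ∃ k : Fin n, 1 ≤ k.val ∧ (u - 1) i k ≠ 0 := ⟨l, hl, hi⟩
        have hch : hex.choose = l := hrow i _ _ hi0 hex.choose_spec.2 hi
        simp only [y, Matrix.of_apply]
        rw [dif_pos hex]
        congr 1
    · rw [Matrix.mul_apply]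
      refine Finset.sum_eq_zero fun i _ => ?_
      rw [Matrix.transpose_apply, hu i l fun hP => ?_, zero_mul]
      have := Fin.lt_def.1 hP.1
      omega

lemma rightSolvable_iff_columns (hu : u - 1 ∈ patAlgebra F (Pm n m))
    (hrow : ∀ i j j' : Fin n, i.val ≠ 0 → (u - 1) i j ≠ 0 → (u - 1) i j' ≠ 0 → j = j')
    (lam : Mat n F) :
    RightSolvable (Pm n m) lam (u - 1) ↔
      ∀ k : Fin n, 1 ≤ k.val → RightSolvable (Pm n m) (lamUK lam u k) (uCol u k - 1) := by
  have single : ∀ (z : Mat n F) (i j k : Fin n), i < j → (u - 1) j k ≠ 0 →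
      (lam * (1 + z)ᵀ * (u - 1)ᵀ : Mat n F) i j = (lam * (1 + z)ᵀ : Mat n F) i k * (u - 1) j k := by
    intro z i j k hij hjk
    rw [Matrix.mul_apply, Finset.sum_eq_single k]
    · rw [Matrix.transpose_apply]
    · intro l _ hl
      rw [Matrix.transpose_apply]
      by_contra hne
      refine hl (hrow j l k ?_ (right_ne_zero_of_mul hne) hjk)
      have := Fin.lt_def.1 hij
      omega
    · simp
  constructor
  · rintro ⟨z, hz, h⟩ k -
    refine ⟨z, hz, fun i j hij => ?_⟩
    rw [right_row_eq hu lam hz hij.1]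
    by_cases hjk : (u - 1) j k = 0
    · rw [hjk, mul_zero]
    · rw [← single z i j k hij.1 hjk, h i j hij]
  · intro h
    choose Z hZ hZz using h
    let z : Mat n F := Matrix.of fun l s => if hl : 1 ≤ l.val then Z l hl l s else 0
    have hz : z ∈ patAlgebra F (Pm n m) := by
      intro l s hls
      simp only [z, Matrix.of_apply]
      split_ifs with hl
      · exact hZ _ _ l s hls
      · rfl
    refine ⟨z, hz, fun i j hij => ?_⟩
    by_cases hex : ∃ k, (u - 1) j k ≠ 0
    · obtain ⟨k, hk⟩ := hex
      have hk1 : 1 ≤ k.val := by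
        have := Fin.lt_def.1 (lt_of_patAlgebra_ne_zero hu hk)
        omega
      rw [single z i j k hij.1 hk, ← hZz k hk1 i j hij, right_row_eq hu lam (hZ k hk1) hij.1]
      congr 1
      rw [Matrix.mul_apply, Matrix.mul_apply]
      refine Finset.sum_congr rfl fun s _ => ?_
      simp [z, hk1]
    · push Not at hex
      rw [Matrix.mul_apply]
      refine Finset.sum_eq_zero fun k _ => ?_
      rw [Matrix.transpose_apply, hex k, mul_zero]

omit [Fintype F] in
/-- Below its first row, a comb superclass representative has at most one nonzero entry in each
row. -/
lemma IsCombClassRep.row_unique {A : Mat n F} (hA : IsCombClassRep m A) {i j j' : Fin n}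
    (hi : i.val ≠ 0) (hj : A i j ≠ 0) (hj' : A i j' ≠ 0) : j = j' := by
  by_contra hne
  have hmem : (i, j) ∈ compOf A (i, j) := Relation.ReflTransGen.refl
  have hmem' : (i, j') ∈ compOf A (i, j) :=
    Relation.ReflTransGen.single ⟨by simpa using hne, hj, hj', Or.inl rfl⟩
  have hcard : 1 < (compOf A (i, j)).ncard :=
    (Set.one_lt_ncard (Set.toFinite _)).2 ⟨_, hmem, _, hmem', by simpa using hne⟩
  obtain ⟨r, r', -, -, a, k, ha, -, -, -, -, -, hS⟩ := hA.2 (i, j) hj hcard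
  rw [hS] at hmem hmem'
  have hanti : ∀ d e, 1 ≤ d → d < e → e ≤ r' → a e < a d := by
    intro d e hd hde
    induction e, hde using Nat.le_induction with
    | base => exact fun he => ha d hd he
    | succ e hde ih =>
      exact fun he => (ha e (by omega) he).trans (ih (by omega))
  rcases hmem with ⟨h, -⟩ | ⟨d, hd1, hdr, hda, hdk⟩
  · exact hi (by simpa using h)
  rcases hmem' with ⟨h, -⟩ | ⟨e, he1, her, hea, hek⟩
  · exact hi (by simpa using h)
  simp only at hda hdk hea hek
  have hde : d = e := by
    rcases lt_trichotomy d e with h | h | h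
    · have := hanti d e hd1 h her
      omega
    · exact h
    · have := hanti e d he1 h hdr
      omega
  subst hde
  exact hne (Fin.ext (by omega))

end Columns

/-- For a comb superclass representative `u ∈ U_(m)` and a comb supercharacter
representative `λ ∈ 𝔫_(m)^*`: `χ^λ(u) ≠ 0` iff `χ^{λ[u,k]}(u[k]) ≠ 0` for all columns `k` with
`2 ≤ k ≤ n` (1-based). -/
theorem stmt15 {n m : ℕ} (hm : 0 < m) (hmn : m < n) {F : Type*} [Field F] [Fintype F]
    (θ : AddChar F ℂ) (hθ : ∃ x, θ x ≠ 1)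
    (u : Mat n F) (hu : u ∈ patGroup (Pm n m)) (hucomb : IsCombClassRep m (u - 1))
    (lam : Mat n F) (hlam : ∀ i j : Fin n, ¬ Pm n m i j → lam i j = 0)
    (hlcomb : IsCombCharRep m lam) :
    superChar (Pm n m) θ lam u ≠ 0 ↔
      ∀ k : Fin n, 1 ≤ k.val →
        superChar (Pm n m) θ (lamUK lam u k) (uCol u k) ≠ 0 := by
  have hX := sub_one_mem_patAlgebra hu
  have hrow : ∀ i j j' : Fin n, i.val ≠ 0 → (u - 1) i j ≠ 0 → (u - 1) i j' ≠ 0 → j = j' :=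
    fun _ _ _ => hucomb.row_unique
  rw [superChar_ne_zero_iff Pm_lt Pm_trans hθ lam u hX, leftSolvable_iff_columns hX hrow,
    rightSolvable_iff_columns hX hrow, ← forall₂_and]
  exact forall₂_congr fun k _ =>
    (superChar_ne_zero_iff Pm_lt Pm_trans hθ _ _ (uCol_sub_one_mem hX k)).symm
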